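/- (Upper bound on revelation probabilities of an incentivizable set) Let Ψ ⊆ [n] satisfy p_i ≤ 1/4 and 2c_i/p_i ≥ 15/16 for every i ∈ Ψ. If there exists a proper scoring rule S with values in [0,1] such that the mechanism (S, Ψ) is incentive compatible, then for every i* ∈ Ψ, Σ_{i∈Ψ} p_i ≤ (16/3)·(1 − 2c_{i*}/p_{i*}) + p_{i*}. -/

import Mathlib

open Finset

namespace KS

abbrev Sig (n : ℕ) := Fin n → Option Bool
abbrev St (n : ℕ) := Fin n → Bool

/-- Posterior probability of state profile `ω` induced by signal profile `σ`:
`ω i = b` with probability 1 when `σ i = some b`, uniform when `σ i = none`. -/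
noncomputable def postProb {n : ℕ} (σ : Sig n) (ω : St n) : ℝ :=
  ∏ i, (σ i).elim ((1:ℝ)/2) (fun b => if ω i = b then 1 else 0)

/-- Expectation of `f` over states, under the posterior induced by `σ`. -/
noncomputable def postExp {n : ℕ} (σ : Sig n) (f : St n → ℝ) : ℝ :=
  ∑ ω : St n, postProb σ ω * f ω

/-- A scoring rule is proper if truthful reporting of the signal maximizes the
expected score under the induced posterior. -/
def Proper {n : ℕ} (S : Sig n → St n → ℝ) : Prop :=
  ∀ σ σ' : Sig n, postExp σ (S σ) ≥ postExp σ (S σ')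

/-- Probability of receiving signal profile `σ` when exerting effort exactly on `Ψ`
(with state-revelation probabilities `p`, states uniform and independent). -/
noncomputable def sigProb {n : ℕ} (p : Fin n → ℝ) (Ψ : Finset (Fin n)) (σ : Sig n) : ℝ :=
  ∏ i, if i ∈ Ψ then (σ i).elim (1 - p i) (fun _ => p i / 2)
       else (σ i).elim 1 (fun _ => 0)

/-- Expected score `E_{σ∼Ψ}[E_{ω∼σ}[S(σ,ω)]]` for exerting effort on `Ψ` and
truthfully reporting. -/
noncomputable def expScore {n : ℕ} (p : Fin n → ℝ) (Ψ : Finset (Fin n))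
    (S : Sig n → St n → ℝ) : ℝ :=
  ∑ σ : Sig n, sigProb p Ψ σ * postExp σ (S σ)

/-- Incentive compatibility of the mechanism `(S, Ψ)`. -/
def IC {n : ℕ} (p c : Fin n → ℝ) (S : Sig n → St n → ℝ) (Ψ : Finset (Fin n)) : Prop :=
  Proper S ∧ ∀ Ψ' : Finset (Fin n),
    expScore p Ψ S - ∑ i ∈ Ψ, c i ≥ expScore p Ψ' S - ∑ i ∈ Ψ', c i

/-- Truncated separate scoring rule with budget `B`. -/
def IsTruncSep {n : ℕ} (B : ℝ) (S : Sig n → St n → ℝ) : Prop :=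
  ∃ (T : Fin n → Option Bool → Bool → ℝ) (d : ℝ),
    ∀ σ ω, S σ ω = min B (max 0 (-d + ∑ i, T i (σ i) (ω i)))

open Classical in
/-- Threshold scoring rule with recommendation set `Ψ` and threshold `η`. -/
noncomputable def thresholdScore {n : ℕ} (Ψ : Finset (Fin n)) (η : ℕ)
    (σ : Sig n) (ω : St n) : ℝ :=
  if ∃ i ∈ Ψ, σ i ≠ none ∧ σ i ≠ some (ω i) then 0
  else if η ≤ (Ψ.filter fun i => σ i = some (ω i)).card then 1
  else (1/2 : ℝ) ^ (η - (Ψ.filter fun i => σ i = some (ω i)).card)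

def IsThreshold {n : ℕ} (S : Sig n → St n → ℝ) : Prop :=
  ∃ (Ψ : Finset (Fin n)) (η : ℕ), ∀ σ ω, S σ ω = thresholdScore Ψ η σ ω

end KS

namespace KS

variable {n : ℕ}

/-- Expectation of `g` over the signals received when exerting effort exactly on `T`. -/
noncomputable def sigExp (p : Fin n → ℝ) (T : Finset (Fin n)) (g : Sig n → ℝ) : ℝ :=
  ∑ σ : Sig n, sigProb p T σ * g σ

/-- Average of `g` over the two ways of revealing the state of task `i`. -/
noncomputable def reveal (i : Fin n) (g : Sig n → ℝ) (σ : Sig n) : ℝ :=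
  (g (Function.update σ i (some true)) + g (Function.update σ i (some false))) / 2

/-- Indicator that the state of task `i` is revealed. -/
noncomputable def revealed (i : Fin n) (σ : Sig n) : ℝ := (σ i).elim 0 (fun _ => 1)

theorem sum_eq_sum_update (i : Fin n) (F : Sig n → ℝ) :
    ∑ σ, F σ = ∑ σ : Sig n, if σ i = none then ∑ a, F (Function.update σ i a) else 0 := by
  have key : ∀ G : Sig n → ℝ, ∑ σ, G σ =
      ∑ a, ∑ r : {j // j ≠ i} → Option Bool, G ((Equiv.funSplitAt i (Option Bool)).symm (a, r)) := by
    intro G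
    rw [← Fintype.sum_prod_type', ← (Equiv.funSplitAt i (Option Bool)).symm.sum_comp]
  rw [key, key]
  have hu : ∀ (a b : Option Bool) (r : {j // j ≠ i} → Option Bool),
      Function.update ((Equiv.funSplitAt i (Option Bool)).symm (b, r)) i a
        = (Equiv.funSplitAt i (Option Bool)).symm (a, r) := by
    intro a b r
    ext1 j
    by_cases h : j = i
    · subst h; simp [Equiv.funSplitAt, Equiv.piSplitAt]
    · simp [Equiv.funSplitAt, Equiv.piSplitAt, h]
  have hi : ∀ (b : Option Bool) (r : {j // j ≠ i} → Option Bool),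
      (Equiv.funSplitAt i (Option Bool)).symm (b, r) i = b := by
    intro b r
    simp [Equiv.funSplitAt, Equiv.piSplitAt]
  simp only [hu, hi]
  rw [Fintype.sum_option (f := fun a => ∑ r, if a = none then _ else _)]
  simp only [reduceCtorEq, if_true, if_false, Finset.sum_const_zero, add_zero]
  exact Finset.sum_comm

theorem sigProb_nonneg {p : Fin n → ℝ} (hp : ∀ i, 0 < p i ∧ p i ≤ 1) (T : Finset (Fin n))
    (σ : Sig n) : 0 ≤ sigProb p T σ := by
  refine Finset.prod_nonneg fun i _ => ?_
  have := hp i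
  split_ifs <;> cases σ i <;> simp <;> linarith

theorem sigProb_eq_zero (p : Fin n → ℝ) {T : Finset (Fin n)} {σ : Sig n} {i : Fin n}
    (hi : i ∉ T) (h : σ i ≠ none) : sigProb p T σ = 0 := by
  refine Finset.prod_eq_zero (Finset.mem_univ i) ?_
  obtain ⟨b, hb⟩ := Option.ne_none_iff_exists'.1 h
  simp [hi, hb]

theorem sigProb_insert_update (p : Fin n → ℝ) {T : Finset (Fin n)} {σ : Sig n} {i : Fin n}
    (hi : i ∉ T) (h : σ i = none) (a : Option Bool) :
    sigProb p (insert i T) (Function.update σ i a)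
      = a.elim (1 - p i) (fun _ => p i / 2) * sigProb p T σ := by
  unfold sigProb
  rw [← Finset.mul_prod_erase _ _ (Finset.mem_univ i),
    ← Finset.mul_prod_erase (f := fun j => if j ∈ T then _ else _) _ (Finset.mem_univ i)]
  simp only [Finset.mem_insert_self, if_true, Function.update_self, hi, if_false, h,
    Option.elim_none, one_mul]
  congr 1
  refine Finset.prod_congr rfl fun j hj => ?_
  have hji := Finset.ne_of_mem_erase hj
  simp [hji]

theorem sigExp_insert (p : Fin n → ℝ) {T : Finset (Fin n)} {i : Fin n} (hi : i ∉ T)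
    (g : Sig n → ℝ) :
    sigExp p (insert i T) g = (1 - p i) * sigExp p T g + p i * sigExp p T (reveal i g) := by
  unfold sigExp
  rw [sum_eq_sum_update i, Finset.mul_sum, Finset.mul_sum, ← Finset.sum_add_distrib]
  refine Finset.sum_congr rfl fun σ _ => ?_
  split_ifs with h
  · have hu : Function.update σ i none = σ := by rw [← h, Function.update_eq_self]
    simp only [sigProb_insert_update p hi h, Fintype.sum_option, Fintype.sum_bool,
      Option.elim_none, Option.elim_some, hu, reveal]
    ring
  · rw [sigProb_eq_zero p hi h]; ring

theorem sigExp_mono {p : Fin n → ℝ} (hp : ∀ i, 0 < p i ∧ p i ≤ 1) {T : Finset (Fin n)}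
    {g h : Sig n → ℝ} (hgh : ∀ σ, (∀ i ∉ T, σ i = none) → g σ ≤ h σ) :
    sigExp p T g ≤ sigExp p T h := by
  refine Finset.sum_le_sum fun σ _ => ?_
  by_cases hσ : ∀ i ∉ T, σ i = none
  · exact mul_le_mul_of_nonneg_left (hgh σ hσ) (sigProb_nonneg hp T σ)
  · push Not at hσ
    obtain ⟨i, hi, h⟩ := hσ
    simp [sigProb_eq_zero p hi h]

theorem sigExp_congr {p : Fin n → ℝ} (hp : ∀ i, 0 < p i ∧ p i ≤ 1) {T : Finset (Fin n)}
    {g h : Sig n → ℝ} (hgh : ∀ σ, (∀ i ∉ T, σ i = none) → g σ = h σ) :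
    sigExp p T g = sigExp p T h :=
  le_antisymm (sigExp_mono hp fun σ hσ => (hgh σ hσ).le)
    (sigExp_mono hp fun σ hσ => (hgh σ hσ).ge)

theorem sigExp_add (p : Fin n → ℝ) (T : Finset (Fin n)) (g h : Sig n → ℝ) :
    sigExp p T (fun σ => g σ + h σ) = sigExp p T g + sigExp p T h := by
  simp [sigExp, mul_add, Finset.sum_add_distrib]

theorem sigExp_const_mul (p : Fin n → ℝ) (T : Finset (Fin n)) (a : ℝ) (g : Sig n → ℝ) :
    sigExp p T (fun σ => a * g σ) = a * sigExp p T g := by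
  simp [sigExp, Finset.mul_sum, mul_left_comm]

theorem sigExp_sum (p : Fin n → ℝ) (T A : Finset (Fin n)) (g : Fin n → Sig n → ℝ) :
    sigExp p T (fun σ => ∑ j ∈ A, g j σ) = ∑ j ∈ A, sigExp p T (g j) := by
  simp only [sigExp, Finset.mul_sum]
  exact Finset.sum_comm

theorem sigExp_const {p : Fin n → ℝ} (T : Finset (Fin n)) (a : ℝ) :
    sigExp p T (fun _ => a) = a := by
  induction T using Finset.induction_on with
  | empty =>
    unfold sigExp
    rw [Fintype.sum_eq_single (fun _ => none)]
    · simp [sigProb]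
    · intro σ hσ
      obtain ⟨i, hi⟩ := Function.ne_iff.1 hσ
      simp [sigProb_eq_zero p (Finset.notMem_empty i) hi]
  | insert i T hi ih =>
    rw [sigExp_insert p hi]
    have : reveal i (fun _ : Sig n => a) = fun _ => a := by ext; simp [reveal]
    rw [this, ih]
    ring

theorem sigExp_mul_revealed {p : Fin n → ℝ} (hp : ∀ i, 0 < p i ∧ p i ≤ 1)
    {T : Finset (Fin n)} {j : Fin n} (hj : j ∈ T) (g : Sig n → ℝ) :
    sigExp p T (fun σ => g σ * revealed j σ) = p j * sigExp p (T.erase j) (reveal j g) := by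
  conv_lhs => rw [← Finset.insert_erase hj]
  rw [sigExp_insert p (Finset.notMem_erase j T)]
  have h0 : sigExp p (T.erase j) (fun σ => g σ * revealed j σ) = 0 := by
    rw [sigExp_congr hp (h := fun _ => 0), sigExp_const]
    intro σ hσ
    simp [revealed, hσ j (Finset.notMem_erase j T)]
  rw [h0, mul_zero, zero_add]
  congr 2
  ext σ
  simp [reveal, revealed]

theorem sigExp_revealed {p : Fin n → ℝ} (hp : ∀ i, 0 < p i ∧ p i ≤ 1)
    {T : Finset (Fin n)} {j : Fin n} (hj : j ∈ T) :
    sigExp p T (revealed j) = p j := by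
  have h := sigExp_mul_revealed hp hj (fun _ => 1)
  have hr : reveal j (fun _ : Sig n => (1 : ℝ)) = fun _ => 1 := by ext; simp [reveal]
  simpa [hr, sigExp_const] using h

theorem sigExp_revealed_mul_revealed {p : Fin n → ℝ} (hp : ∀ i, 0 < p i ∧ p i ≤ 1)
    {T : Finset (Fin n)} {j k : Fin n} (hj : j ∈ T) (hk : k ∈ T) :
    sigExp p T (fun σ => revealed k σ * revealed j σ) = if k = j then p j else p k * p j := by
  split_ifs with h
  · subst h
    rw [← sigExp_revealed hp hk]
    congr 1
    ext σ
    unfold revealed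
    cases σ k <;> simp
  · rw [sigExp_mul_revealed hp hj]
    have hr : reveal j (revealed k) = revealed k := by
      ext σ
      simp [reveal, revealed, Function.update_of_ne h]
    rw [hr, sigExp_revealed hp (Finset.mem_erase.2 ⟨h, hk⟩), mul_comm]

/-- The variance of the number of revealed tasks is at most its mean. -/
theorem sigExp_sq_sub_le {p : Fin n → ℝ} (hp : ∀ i, 0 < p i ∧ p i ≤ 1)
    (T : Finset (Fin n)) :
    sigExp p T (fun σ => (∑ j ∈ T, revealed j σ - ∑ j ∈ T, p j) ^ 2) ≤ ∑ j ∈ T, p j := by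
  have h2 : sigExp p T (fun σ => ∑ j ∈ T, ∑ k ∈ T, revealed k σ * revealed j σ)
      ≤ (∑ j ∈ T, p j) ^ 2 + ∑ j ∈ T, p j := by
    rw [sigExp_sum, sq, Finset.sum_mul, ← Finset.sum_add_distrib]
    refine Finset.sum_le_sum fun j hj => ?_
    rw [sigExp_sum, Finset.mul_sum]
    calc ∑ k ∈ T, sigExp p T (fun σ => revealed k σ * revealed j σ)
        ≤ ∑ k ∈ T, (p j * p k + if k = j then p j else 0) := by
          refine Finset.sum_le_sum fun k hk => ?_
          rw [sigExp_revealed_mul_revealed hp hj hk]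
          have := mul_pos (hp j).1 (hp k).1
          split_ifs <;> linarith
      _ = _ := by simp [Finset.sum_add_distrib, hj]
  have h1 : sigExp p T (fun σ => ∑ j ∈ T, revealed j σ) = ∑ j ∈ T, p j := by
    rw [sigExp_sum]
    exact Finset.sum_congr rfl fun j hj => sigExp_revealed hp hj
  set l := ∑ j ∈ T, p j
  have h3 : (fun σ : Sig n => (∑ j ∈ T, revealed j σ - l) ^ 2) = fun σ =>
      (∑ j ∈ T, ∑ k ∈ T, revealed k σ * revealed j σ)
        + ((-2 * l) * (∑ j ∈ T, revealed j σ) + l ^ 2) := by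
    ext σ
    simp only [← Finset.sum_mul, ← Finset.mul_sum]
    ring
  rw [h3, sigExp_add, sigExp_add, sigExp_const_mul, sigExp_const, h1]
  linarith

theorem postProb_nonneg (σ : Sig n) (ω : St n) : 0 ≤ postProb σ ω := by
  refine Finset.prod_nonneg fun i _ => ?_
  cases σ i <;> simp
  split_ifs <;> simp

theorem sum_postProb (σ : Sig n) : ∑ ω, postProb σ ω = 1 := by
  unfold postProb
  rw [← Fintype.prod_sum (fun i (a : Bool) =>
    (σ i).elim ((1 : ℝ) / 2) (fun b => if a = b then 1 else 0))]
  refine Finset.prod_eq_one fun i _ => ?_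
  cases σ i with
  | none => simp
  | some b => cases b <;> simp

theorem postExp_mem_Icc (σ : Sig n) {f : St n → ℝ} (hf : ∀ ω, f ω ∈ Set.Icc (0 : ℝ) 1) :
    postExp σ f ∈ Set.Icc (0 : ℝ) 1 := by
  refine ⟨Finset.sum_nonneg fun ω _ => mul_nonneg (postProb_nonneg σ ω) (hf ω).1, ?_⟩
  rw [← sum_postProb σ]
  exact Finset.sum_le_sum fun ω _ => mul_le_of_le_one_right (postProb_nonneg σ ω) (hf ω).2

theorem postExp_of_eq_none {σ : Sig n} {i : Fin n} (h : σ i = none) (f : St n → ℝ) :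
    postExp σ f = (postExp (Function.update σ i (some true)) f
      + postExp (Function.update σ i (some false)) f) / 2 := by
  unfold postExp
  rw [← Finset.sum_add_distrib, Finset.sum_div]
  refine Finset.sum_congr rfl fun ω _ => ?_
  unfold postProb
  have hpr : ∀ τ : Sig n, (∏ j, (τ j).elim ((1 : ℝ) / 2) (fun b => if ω j = b then 1 else 0))
      = (τ i).elim ((1 : ℝ) / 2) (fun b => if ω i = b then 1 else 0) *
        ∏ j ∈ Finset.univ.erase i, (τ j).elim ((1 : ℝ) / 2) (fun b => if ω j = b then 1 else 0) :=
    fun τ => (Finset.mul_prod_erase _ _ (Finset.mem_univ i)).symm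
  have hrest : ∀ a : Option Bool, ∏ j ∈ Finset.univ.erase i,
        (Function.update σ i a j).elim ((1 : ℝ) / 2) (fun b => if ω j = b then 1 else 0)
      = ∏ j ∈ Finset.univ.erase i,
        (σ j).elim ((1 : ℝ) / 2) (fun b => if ω j = b then 1 else 0) := by
    intro a
    refine Finset.prod_congr rfl fun j hj => ?_
    rw [Function.update_of_ne (Finset.ne_of_mem_erase hj)]
  rw [hpr σ, hpr (Function.update σ i _), hpr (Function.update σ i _), hrest, hrest, h]
  cases ω i <;> simp <;> ring

/-- Expected score of truthfully reporting the signal `σ`. -/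
noncomputable def util (S : Sig n → St n → ℝ) (σ : Sig n) : ℝ := postExp σ (S σ)

theorem util_mem_Icc {S : Sig n → St n → ℝ} (hbd : ∀ σ ω, S σ ω ∈ Set.Icc (0 : ℝ) 1)
    (σ : Sig n) : util S σ ∈ Set.Icc (0 : ℝ) 1 :=
  postExp_mem_Icc σ (hbd σ)

theorem reveal_le {g : Sig n → ℝ} {a : ℝ} (hg : ∀ σ, g σ ≤ a) (i : Fin n) (σ : Sig n) :
    reveal i g σ ≤ a := by
  unfold reveal
  linarith [hg (Function.update σ i (some true)), hg (Function.update σ i (some false))]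

theorem reveal_util_le {S : Sig n → St n → ℝ} (hbd : ∀ σ ω, S σ ω ∈ Set.Icc (0 : ℝ) 1)
    (hS : Proper S) {σ : Sig n} {i : Fin n} (h : σ i = none) :
    reveal i (util S) σ ≤ 2 * util S σ := by
  have ht := hS σ (Function.update σ i (some true))
  have hf := hS σ (Function.update σ i (some false))
  rw [postExp_of_eq_none h (S (Function.update σ i _))] at ht hf
  have h1 := (postExp_mem_Icc (Function.update σ i (some false))
    (hbd (Function.update σ i (some true)))).1
  have h2 := (postExp_mem_Icc (Function.update σ i (some true))
    (hbd (Function.update σ i (some false)))).1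
  unfold reveal util
  linarith

/-- Incentive compatibility against dropping the task `i`. -/
theorem IC.le_marginal {p c : Fin n → ℝ} (hp : ∀ i, 0 < p i ∧ p i ≤ 1)
    {S : Sig n → St n → ℝ} {Ψ : Finset (Fin n)} (hIC : IC p c S Ψ) {i : Fin n} (hi : i ∈ Ψ) :
    2 * c i / p i ≤ 2 * (sigExp p (Ψ.erase i) (reveal i (util S))
      - sigExp p (Ψ.erase i) (util S)) := by
  have h : expScore p Ψ S - ∑ j ∈ Ψ, c j
      ≥ expScore p (Ψ.erase i) S - ∑ j ∈ Ψ.erase i, c j := hIC.2 (Ψ.erase i)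
  have h1 : expScore p Ψ S = sigExp p (insert i (Ψ.erase i)) (util S) := by
    rw [Finset.insert_erase hi]; rfl
  have h2 : expScore p (Ψ.erase i) S = sigExp p (Ψ.erase i) (util S) := rfl
  rw [h1, h2, sigExp_insert p (Finset.notMem_erase i Ψ), ← Finset.add_sum_erase _ _ hi] at h
  rw [div_le_iff₀ (hp i).1]
  linarith

theorem IC.sigExp_abs_le {p c : Fin n → ℝ} (hp : ∀ i, 0 < p i ∧ p i ≤ 1)
    {S : Sig n → St n → ℝ} (hbd : ∀ σ ω, S σ ω ∈ Set.Icc (0 : ℝ) 1)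
    {Ψ : Finset (Fin n)} (hIC : IC p c S Ψ) {i : Fin n} (hi : i ∈ Ψ) :
    sigExp p (Ψ.erase i) (fun σ => |2 * util S σ - 1|) ≤ 1 - 2 * c i / p i := by
  have h : sigExp p (Ψ.erase i) (fun σ => |2 * util S σ - 1|) ≤ sigExp p (Ψ.erase i)
      (fun σ => 1 + ((-2) * reveal i (util S) σ + 2 * util S σ)) := by
    refine sigExp_mono hp fun σ hσ => ?_
    have h1 := reveal_util_le hbd hIC.1 (hσ i (Finset.notMem_erase i Ψ))
    have h2 := reveal_le (fun τ => (util_mem_Icc hbd τ).2) i σ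
    rw [abs_le]
    constructor <;> linarith
  rw [sigExp_add, sigExp_add, sigExp_const, sigExp_const_mul, sigExp_const_mul] at h
  linarith [hIC.le_marginal hp hi]

theorem IC.le_sigExp_reveal {p c : Fin n → ℝ} (hp : ∀ i, 0 < p i ∧ p i ≤ 1)
    {S : Sig n → St n → ℝ} (hbd : ∀ σ ω, S σ ω ∈ Set.Icc (0 : ℝ) 1)
    {Ψ : Finset (Fin n)} (hIC : IC p c S Ψ) {j : Fin n} (hj : j ∈ Ψ) :
    2 * c j / p j ≤ sigExp p (Ψ.erase j) (reveal j (util S)) := by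
  have h : sigExp p (Ψ.erase j) (reveal j (util S))
      ≤ sigExp p (Ψ.erase j) (fun σ => 2 * util S σ) :=
    sigExp_mono hp fun σ hσ => reveal_util_le hbd hIC.1 (hσ j (Finset.notMem_erase j Ψ))
  rw [sigExp_const_mul] at h
  linarith [hIC.le_marginal hp hj]

theorem IC.le_sigExp_erase_erase {p c : Fin n → ℝ} (hp : ∀ i, 0 < p i ∧ p i ≤ 1)
    {S : Sig n → St n → ℝ} (hbd : ∀ σ ω, S σ ω ∈ Set.Icc (0 : ℝ) 1)
    {Ψ : Finset (Fin n)} (hIC : IC p c S Ψ) {i j : Fin n} (hi : i ∈ Ψ) (hj : j ∈ Ψ)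
    (hji : j ≠ i) (hpi : p i ≤ 1 / 4) (hratio : 15 / 16 ≤ 2 * c j / p j) :
    11 / 12 ≤ sigExp p ((Ψ.erase i).erase j) (reveal j (util S)) := by
  have h := hIC.le_sigExp_reveal hp hbd hj
  rw [← Finset.insert_erase (Finset.mem_erase.2 ⟨hji.symm, hi⟩),
    sigExp_insert p (Finset.notMem_erase i _), Finset.erase_right_comm] at h
  have h1 : sigExp p ((Ψ.erase i).erase j) (reveal i (reveal j (util S))) ≤ 1 := by
    rw [← sigExp_const (p := p) ((Ψ.erase i).erase j) 1]
    exact sigExp_mono hp fun σ _ =>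
      reveal_le (reveal_le (fun τ => (util_mem_Icc hbd τ).2) j) i σ
  nlinarith [(hp i).1]

theorem IC.le_sigExp_mul_revealed {p c : Fin n → ℝ} (hp : ∀ i, 0 < p i ∧ p i ≤ 1)
    {S : Sig n → St n → ℝ} (hbd : ∀ σ ω, S σ ω ∈ Set.Icc (0 : ℝ) 1)
    {Ψ : Finset (Fin n)} (hIC : IC p c S Ψ) {i j : Fin n} (hi : i ∈ Ψ) (hj : j ∈ Ψ)
    (hji : j ≠ i) (hpi : p i ≤ 1 / 4) (hratio : 15 / 16 ≤ 2 * c j / p j) :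
    5 / 6 * p j ≤ sigExp p (Ψ.erase i) (fun σ => (2 * util S σ - 1) * revealed j σ) := by
  rw [sigExp_mul_revealed hp (Finset.mem_erase.2 ⟨hji, hj⟩)]
  have hr : reveal j (fun σ => 2 * util S σ - 1)
      = fun σ => 2 * reveal j (util S) σ + (-1) := by
    ext σ; simp only [reveal]; ring
  rw [hr, sigExp_add, sigExp_const_mul, sigExp_const]
  have h := hIC.le_sigExp_erase_erase hp hbd hi hj hji hpi hratio
  nlinarith [(hp j).1]

end KS

/-- Upper bound on revelation probabilities of an incentivizable set
(Lemma `asym-upper-bound`). -/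
theorem stmt8 {n : ℕ} (p c : Fin n → ℝ)
    (hp : ∀ i, 0 < p i ∧ p i ≤ 1) (hc : ∀ i, 0 < c i)
    (Ψ : Finset (Fin n))
    (hp4 : ∀ i ∈ Ψ, p i ≤ 1/4) (hratio : ∀ i ∈ Ψ, 15/16 ≤ 2 * c i / p i)
    (S : KS.Sig n → KS.St n → ℝ) (hbd : ∀ σ ω, S σ ω ∈ Set.Icc (0:ℝ) 1)
    (hIC : KS.IC p c S Ψ) :
    ∀ istar ∈ Ψ, ∑ i ∈ Ψ, p i ≤ (16/3) * (1 - 2 * c istar / p istar) + p istar := by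
  intro i hi
  rw [← Finset.sum_erase_add _ _ hi]
  set T := Ψ.erase i
  set l := ∑ j ∈ T, p j with hl
  set f : KS.Sig n → ℝ := fun σ => 2 * KS.util S σ - 1 with hf
  have habs : KS.sigExp p T (fun σ => |f σ|) ≤ 1 - 2 * c i / p i := hIC.sigExp_abs_le hp hbd hi
  have hvar := KS.sigExp_sq_sub_le hp T
  have hcov : 5 / 6 * l ≤ KS.sigExp p T (fun σ => f σ * ∑ j ∈ T, KS.revealed j σ) := by
    simp only [Finset.mul_sum, KS.sigExp_sum, hl]
    refine Finset.sum_le_sum fun j hj => ?_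
    obtain ⟨hji, hjΨ⟩ := Finset.mem_erase.1 hj
    exact hIC.le_sigExp_mul_revealed hp hbd hi hjΨ hji (hp4 i hi) (hratio j hjΨ)
  have hl0 : 0 ≤ l := Finset.sum_nonneg fun j _ => (hp j).1.le
  have hle : KS.sigExp p T (fun σ => f σ * ∑ j ∈ T, KS.revealed j σ) ≤ KS.sigExp p T (fun σ =>
      (l + 1 / 2) * |f σ| + 1 / 2 * (∑ j ∈ T, KS.revealed j σ - l) ^ 2) := by
    refine KS.sigExp_mono hp fun σ _ => ?_
    have hf1 : |f σ| ≤ 1 := by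
      have := KS.util_mem_Icc hbd σ
      rw [abs_le]
      constructor <;> simp only [hf] <;> linarith [this.1, this.2]
    have hsq : f σ ^ 2 ≤ |f σ| := by
      rw [← sq_abs]
      nlinarith [abs_nonneg (f σ)]
    have hfl : l * f σ ≤ l * |f σ| := mul_le_mul_of_nonneg_left (le_abs_self _) hl0
    nlinarith [sq_nonneg (f σ - (∑ j ∈ T, KS.revealed j σ - l))]
  rw [KS.sigExp_add, KS.sigExp_const_mul, KS.sigExp_const_mul] at hle
  have hk := hratio i hi
  have hk0 : 0 ≤ KS.sigExp p T (fun σ => |f σ|) := by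
    rw [← KS.sigExp_const (p := p) T 0]
    exact KS.sigExp_mono hp fun σ _ => abs_nonneg _
  nlinarith
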